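/- arXiv:1809.09843 — 5 statements merged into one kernel-verified Lean document; each statement's English description precedes it below -/
import Mathlib

section
/- For every x ∈ ℝ and every natural number j, the j-fold iterate of f satisfies |f^j(x) − (1−λ)^j·x| ≤ A·(1 − (1−λ)^j). -/
/-- A map within `A * (1 - q)` of multiplication by `q ≥ 0` has `j`-th iterate within
`A * (1 - q ^ j)` of multiplication by `q ^ j`. -/
theorem abs_iterate_sub_pow_mul_le {f : ℝ → ℝ} {q A : ℝ} (hq : 0 ≤ q)
    (h : ∀ y, |f y - q * y| ≤ A * (1 - q)) (x : ℝ) (j : ℕ) :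
    |f^[j] x - q ^ j * x| ≤ A * (1 - q ^ j) := by
  induction j with
  | zero => simp
  | succ j ih =>
    rw [Function.iterate_succ_apply']
    calc |f (f^[j] x) - q ^ (j + 1) * x|
        = |(f (f^[j] x) - q * f^[j] x) + q * (f^[j] x - q ^ j * x)| := by ring_nf
      _ ≤ |f (f^[j] x) - q * f^[j] x| + q * |f^[j] x - q ^ j * x| := by
        simpa only [abs_mul, abs_of_nonneg hq] using
          abs_add_le (f (f^[j] x) - q * f^[j] x) (q * (f^[j] x - q ^ j * x))
      _ ≤ A * (1 - q) + q * (A * (1 - q ^ j)) := by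
        gcongr
        exact h _
      _ = A * (1 - q ^ (j + 1)) := by ring

theorem abs_arctan_le_pi_div_two (t : ℝ) : |Real.arctan t| ≤ Real.pi / 2 :=
  abs_le.2 ⟨by linarith [Real.neg_pi_div_two_lt_arctan t], (Real.arctan_lt_pi_div_two t).le⟩

/-- `|f^j(x) − (1−λ)^j x| ≤ A(1 − (1−λ)^j)` for every `x` and `j`. -/
theorem sd_map_iterate_bound
    (a b μ lam A : ℝ) (hb : 0 < b) (hμ : 0 < μ) (hlam : 0 < lam) (hlam1 : lam < 1)
    (f : ℝ → ℝ)
    (hf : ∀ y : ℝ, f y = (1 - lam) * y + (a / b) * lam - (lam / b) * Real.arctan (μ * y))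
    (hA : A = |a| / b + Real.pi / (2 * b)) :
    ∀ (x : ℝ) (j : ℕ), |f^[j] x - (1 - lam) ^ j * x| ≤ A * (1 - (1 - lam) ^ j) := by
  refine abs_iterate_sub_pow_mul_le (sub_nonneg.2 hlam1.le) fun y => ?_
  calc |f y - (1 - lam) * y|
      = |lam / b * (a - Real.arctan (μ * y))| := by rw [hf]; ring_nf
    _ = lam / b * |a - Real.arctan (μ * y)| := by rw [abs_mul, abs_of_pos (div_pos hlam hb)]
    _ ≤ lam / b * (|a| + Real.pi / 2) := by
      gcongr
      exact (abs_sub _ _).trans (by gcongr; exact abs_arctan_le_pi_div_two _)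
    _ = A * (1 - (1 - lam)) := by
      rw [hA]
      field_simp
      ring
end

section
/- (Theorem 1, boundedness part.) For every Δ ≥ 1, every γ ∈ ℝ and every initial condition x₁ ∈ ℝ, the impulsed orbit (x_n)_{n≥1} is bounded; more precisely, for all n ≥ 1, |x_n| ≤ |x₁| + (|γ| + A)/(1 − (1−λ)^Δ) + |γ| + 2A. -/
theorem abs_supply_demand_map_le {a b lam : ℝ} (hb : 0 < b) (hlam : 0 < lam) (hlam1 : lam < 1)
    (y t : ℝ) :
    |(1 - lam) * y + (a / b) * lam - (lam / b) * Real.arctan t| ≤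
      (1 - lam) * |y| + lam * (|a| / b + Real.pi / (2 * b)) := by
  have harctan : |Real.arctan t| ≤ Real.pi / 2 :=
    abs_le.2 ⟨by linarith [Real.neg_pi_div_two_lt_arctan t], (Real.arctan_lt_pi_div_two t).le⟩
  calc |(1 - lam) * y + (a / b) * lam - (lam / b) * Real.arctan t|
      ≤ |(1 - lam) * y| + |(a / b) * lam| + |(lam / b) * Real.arctan t| :=
        (abs_sub _ _).trans (by gcongr; exact abs_add_le _ _)
    _ = (1 - lam) * |y| + (|a| / b) * lam + (lam / b) * |Real.arctan t| := by
        rw [abs_mul, abs_mul, abs_mul, abs_div, abs_div, abs_of_pos hb, abs_of_pos hlam,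
          abs_of_pos (sub_pos.2 hlam1)]
    _ ≤ (1 - lam) * |y| + (|a| / b) * lam + (lam / b) * (Real.pi / 2) := by gcongr
    _ = (1 - lam) * |y| + lam * (|a| / b + Real.pi / (2 * b)) := by field_simp; ring

/-- A sequence contracted towards `A` by the factor `p` at each step and increased by `g` every
`Δ` steps stays below `A + p ^ (n % Δ) * M` as soon as `g ≤ (1 - p ^ Δ) * M`. -/
theorem impulsed_contraction_le {p A g M : ℝ} {Δ : ℕ} (hΔ : 0 < Δ) (hp : 0 ≤ p)
    (hM : g ≤ (1 - p ^ Δ) * M) {v : ℕ → ℝ} (h0 : v 0 ≤ A + M)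
    (hv : ∀ n, v (n + 1) ≤ p * v n + (1 - p) * A + if Δ ∣ n + 1 then g else 0) (n : ℕ) :
    v n ≤ A + p ^ (n % Δ) * M := by
  induction n with
  | zero => simpa using h0
  | succ n ih =>
    have hstep := hv n
    have hmul : p * v n ≤ p * A + p ^ (n % Δ + 1) * M := by
      calc p * v n ≤ p * (A + p ^ (n % Δ) * M) := by gcongr
        _ = p * A + p ^ (n % Δ + 1) * M := by ring
    have hmod : (n + 1) % Δ = (n % Δ + 1) % Δ := (Nat.mod_add_mod n Δ 1).symm
    have hle : n % Δ + 1 ≤ Δ := Nat.mod_lt n hΔ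
    rcases hle.lt_or_eq with hlt | hlast
    · rw [Nat.mod_eq_of_lt hlt] at hmod
      rw [if_neg (by rw [Nat.dvd_iff_mod_eq_zero, hmod]; simp)] at hstep
      rw [hmod]
      linarith
    · rw [hlast, Nat.mod_self] at hmod
      rw [if_pos (Nat.dvd_of_mod_eq_zero hmod)] at hstep
      rw [hlast] at hmul
      rw [hmod]
      linarith

/-- Theorem 1, boundedness part: every impulsed orbit is bounded, with the
explicit bound `|x_n| ≤ |x₁| + (|γ|+A)/(1−(1−λ)^Δ) + |γ| + 2A`. -/
theorem impulsed_orbit_bounded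
    (a b μ lam γ A : ℝ) (hb : 0 < b) (hμ : 0 < μ) (hlam : 0 < lam) (hlam1 : lam < 1)
    (f : ℝ → ℝ)
    (hf : ∀ y : ℝ, f y = (1 - lam) * y + (a / b) * lam - (lam / b) * Real.arctan (μ * y))
    (hA : A = |a| / b + Real.pi / (2 * b))
    (Δ : ℕ) (hΔ : 1 ≤ Δ)
    (x : ℕ → ℝ)
    (hx : ∀ n : ℕ, 1 ≤ n → x (n + 1) = if Δ ∣ n then f (x n) + γ else f (x n)) :
    ∀ n : ℕ, 1 ≤ n →
      |x n| ≤ |x 1| + (|γ| + A) / (1 - (1 - lam) ^ Δ) + |γ| + 2 * A := by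
  intro n hn
  have hp : 0 ≤ 1 - lam := by linarith
  have hq : 0 < 1 - (1 - lam) ^ Δ :=
    sub_pos.2 (pow_lt_one₀ hp (by linarith) (by omega))
  have hA0 : 0 ≤ A := by rw [hA]; positivity
  have hfA : ∀ y, |f y| ≤ (1 - lam) * |y| + lam * A := fun y => by
    rw [hf, hA]; exact abs_supply_demand_map_le hb hlam hlam1 y _
  set M : ℝ := |x 1| + |γ| / (1 - (1 - lam) ^ Δ) with hMdef
  have hM0 : 0 ≤ M := by positivity
  have hM : |γ| ≤ (1 - (1 - lam) ^ Δ) * M := by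
    rw [hMdef, mul_add, mul_div_cancel₀ _ hq.ne']
    linarith [mul_nonneg hq.le (abs_nonneg (x 1))]
  have hstart : |x (0 + 1)| ≤ A + M := by
    have : 0 ≤ |γ| / (1 - (1 - lam) ^ Δ) := by positivity
    rw [zero_add]; linarith
  have hbound := impulsed_contraction_le hΔ hp hM (v := fun n => |x (n + 1)|) hstart
    (fun n => by
      have hfn := hfA (x (n + 1))
      rw [hx (n + 1) (by omega)]
      split_ifs
      · linarith [abs_add_le (f (x (n + 1))) γ]
      · linarith) (n - 1)
  rw [Nat.sub_add_cancel hn] at hbound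
  have hpow : (1 - lam) ^ ((n - 1) % Δ) * M ≤ M :=
    mul_le_of_le_one_left hM0 (pow_le_one₀ hp (by linarith))
  have hAq : 0 ≤ A / (1 - (1 - lam) ^ Δ) := by positivity
  rw [add_div]
  linarith [abs_nonneg γ]
end

section
/- Let k₀ ≥ 0. Then f is Lipschitz on the half-line [k₀, ∞) with Lipschitz constant L = 1 − λ + λμ/(b(μ²k₀² + 1)): for all x, y ≥ k₀, |f(x) − f(y)| ≤ L·|x − y|. Moreover, if μ/(μ²k₀² + 1) < b, then L < 1. -/
/-- `arctan (μ * ·)` is Lipschitz on `[k, ∞)` with constant `μ / (μ ^ 2 * k ^ 2 + 1)`. -/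
theorem abs_arctan_mul_sub_le {μ k x y : ℝ} (hμ : 0 < μ) (hk : 0 ≤ k) (hx : k ≤ x) (hy : k ≤ y) :
    |Real.arctan (μ * x) - Real.arctan (μ * y)| ≤ μ / (μ ^ 2 * k ^ 2 + 1) * |x - y| := by
  have hderiv : ∀ t ∈ Set.Ici k, HasDerivWithinAt (fun t => Real.arctan (μ * t))
      (1 / (1 + (μ * t) ^ 2) * (μ * 1)) (Set.Ici k) t := fun t _ =>
    (((hasDerivAt_id t).const_mul μ).arctan).hasDerivWithinAt
  refine (convex_Ici k).norm_image_sub_le_of_norm_hasDerivWithin_le hderiv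
    (fun t ht => ?_) hy hx
  have hkt : k ≤ t := ht
  rw [Real.norm_of_nonneg (by positivity), mul_one, one_div_mul_eq_div, mul_pow, add_comm]
  gcongr

/-- `f` is Lipschitz on `[k₀, ∞)` with constant
`L = 1 − λ + λμ/(b(μ²k₀²+1))`; moreover `L < 1` whenever `μ/(μ²k₀²+1) < b`. -/
theorem sd_map_lipschitz_on_halfline
    (a b μ lam : ℝ) (hb : 0 < b) (hμ : 0 < μ) (hlam : 0 < lam) (hlam1 : lam < 1)
    (f : ℝ → ℝ)
    (hf : ∀ y : ℝ, f y = (1 - lam) * y + (a / b) * lam - (lam / b) * Real.arctan (μ * y))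
    (k₀ : ℝ) (hk₀ : 0 ≤ k₀) :
    (∀ x y : ℝ, k₀ ≤ x → k₀ ≤ y →
        |f x - f y| ≤ (1 - lam + lam * μ / (b * (μ ^ 2 * k₀ ^ 2 + 1))) * |x - y|) ∧
      (μ / (μ ^ 2 * k₀ ^ 2 + 1) < b →
        1 - lam + lam * μ / (b * (μ ^ 2 * k₀ ^ 2 + 1)) < 1) := by
  have hL : lam * μ / (b * (μ ^ 2 * k₀ ^ 2 + 1)) = lam / b * (μ / (μ ^ 2 * k₀ ^ 2 + 1)) :=
    mul_div_mul_comm _ _ _ _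
  rw [hL]
  refine ⟨fun x y hx hy => ?_, fun h => ?_⟩
  · have hsplit : f x - f y = (1 - lam) * (x - y)
        - lam / b * (Real.arctan (μ * x) - Real.arctan (μ * y)) := by
      rw [hf, hf]; ring
    have hlb : 0 ≤ lam / b := by positivity
    calc |f x - f y|
        ≤ |(1 - lam) * (x - y)| + |lam / b * (Real.arctan (μ * x) - Real.arctan (μ * y))| := by
          rw [hsplit]; exact abs_sub _ _
      _ = (1 - lam) * |x - y| + lam / b * |Real.arctan (μ * x) - Real.arctan (μ * y)| := by
          rw [abs_mul, abs_mul, abs_of_pos (sub_pos.2 hlam1), abs_of_nonneg hlb]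
      _ ≤ (1 - lam) * |x - y| + lam / b * (μ / (μ ^ 2 * k₀ ^ 2 + 1) * |x - y|) := by
          gcongr
          exact abs_arctan_mul_sub_le hμ hk₀ hx hy
      _ = (1 - lam + lam / b * (μ / (μ ^ 2 * k₀ ^ 2 + 1))) * |x - y| := by ring
  · have hlt : lam / b * (μ / (μ ^ 2 * k₀ ^ 2 + 1)) < lam / b * b := by gcongr
    rw [div_mul_cancel₀ _ hb.ne'] at hlt
    linarith
end

section
/- The interval [−A, A] is invariant under f: for every x ∈ ℝ with |x| ≤ A one has |f(x)| ≤ A. -/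
/-- the interval `[−A, A]` is invariant under `f`. -/
theorem sd_map_interval_invariant
    (a b μ lam A : ℝ) (hb : 0 < b) (hμ : 0 < μ) (hlam : 0 < lam) (hlam1 : lam < 1)
    (f : ℝ → ℝ)
    (hf : ∀ y : ℝ, f y = (1 - lam) * y + (a / b) * lam - (lam / b) * Real.arctan (μ * y))
    (hA : A = |a| / b + Real.pi / (2 * b)) :
    ∀ x : ℝ, |x| ≤ A → |f x| ≤ A := by
  intro x hx
  have harctan : |Real.arctan (μ * x)| ≤ Real.pi / 2 :=
    abs_le.2 ⟨by linarith [Real.neg_pi_div_two_lt_arctan (μ * x)],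
      (Real.arctan_lt_pi_div_two (μ * x)).le⟩
  have hexcess : |(a - Real.arctan (μ * x)) / b| ≤ A := by
    have hA' : A = (|a| + Real.pi / 2) / b := by rw [hA]; field_simp
    rw [hA', abs_div, abs_of_pos hb]
    gcongr
    exact (abs_sub _ _).trans (by gcongr)
  have hconvex : f x = (1 - lam) * x + lam * ((a - Real.arctan (μ * x)) / b) := by
    rw [hf]; ring
  rw [abs_le] at hx hexcess ⊢
  rw [hconvex]
  constructor <;> nlinarith
end

section
/- (Theorem 3, boundedness part, concrete parameters.) Let a = −1, b = 1/4, μ = 15, λ = 3/10, so that A = |a|/b + π/(2b) = 4 + 2π. Then for every integer Δ ≥ 1, every γ ∈ ℝ and the initial condition x₁ = 7/20, the impulsed orbit (x_n)_{n≥1} satisfies |x_n| ≤ 7/20 + (|γ| + 4 + 2π)/(1 − (7/10)^Δ) + |γ| + 2(4 + 2π) for all n ≥ 1; in particular all iterations are bounded. -/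
/-- A nonnegative impulse `g` every `d` steps, damped by the factor `q` at each step, keeps a sequence
starting at or below `0` below the fixed point `g / (1 - q ^ d)` of the accumulated impulses. -/
theorem le_div_one_sub_pow_of_impulsed_contraction {q g : ℝ} (hq0 : 0 ≤ q) (hq1 : q < 1)
    (hg : 0 ≤ g) {d : ℕ} (hd : 1 ≤ d) {v : ℕ → ℝ} (hv0 : v 0 ≤ 0)
    (hv : ∀ n, v (n + 1) ≤ q * v n + if d ∣ n + 1 then g else 0) (n : ℕ) :
    v n ≤ g / (1 - q ^ d) := by
  have hqd : 0 < 1 - q ^ d := sub_pos.2 (pow_lt_one₀ hq0 hq1 (by omega))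
  set M := g / (1 - q ^ d) with hM
  have hM0 : 0 ≤ M := div_nonneg hg hqd.le
  have hMg : q ^ d * M + g = M := by
    rw [hM]
    field_simp
    ring
  have key : ∀ n, v n ≤ q ^ (n % d) * M := by
    intro n
    induction n with
    | zero => simpa using hv0.trans hM0
    | succ n ih =>
      have step := hv n
      have hmul := mul_le_mul_of_nonneg_left ih hq0
      rw [← mul_assoc, ← pow_succ'] at hmul
      split_ifs at step with h
      · have hr : n % d + 1 = d := by
          have hlt := Nat.mod_lt n hd
          have hdvd : d ∣ n % d + 1 := by
            rw [Nat.dvd_iff_mod_eq_zero, Nat.mod_add_mod]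
            exact Nat.mod_eq_zero_of_dvd h
          exact le_antisymm hlt (Nat.le_of_dvd (Nat.succ_pos _) hdvd)
        rw [hr] at hmul
        rw [Nat.mod_eq_zero_of_dvd h, pow_zero, one_mul]
        linarith
      · have hr : (n + 1) % d = n % d + 1 := by
          have hlt : n % d + 1 < d := by
            refine lt_of_le_of_ne (Nat.mod_lt n hd) fun hr => h ?_
            rw [Nat.dvd_iff_mod_eq_zero, ← Nat.mod_add_mod, hr, Nat.mod_self]
          rw [← Nat.mod_add_mod, Nat.mod_eq_of_lt hlt]
        rw [hr]
        linarith
  exact (key n).trans (mul_le_of_le_one_left hM0 (pow_le_one₀ hq0 hq1.le))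

theorem abs_supplyDemand_le (y : ℝ) :
    |(7 / 10) * y - 6 / 5 - (6 / 5) * Real.arctan (15 * y)| ≤
      (7 / 10) * |y| + (3 / 10) * (4 + 2 * Real.pi) := by
  have h1 := Real.arctan_lt_pi_div_two (15 * y)
  have h2 := Real.neg_pi_div_two_lt_arctan (15 * y)
  have h3 := le_abs_self y
  have h4 := neg_abs_le y
  rw [abs_le]
  constructor <;> linarith


/-- Theorem 3, boundedness part, concrete parameters
`a = −1, b = 1/4, μ = 15, λ = 3/10`, so `A = 4 + 2π`: for every `Δ ≥ 1`, every `γ`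
and the initial condition `x₁ = 7/20`, the impulsed orbit satisfies
`|x_n| ≤ 7/20 + (|γ| + 4 + 2π)/(1 − (7/10)^Δ) + |γ| + 2(4 + 2π)` for all `n ≥ 1`. -/
theorem concrete_impulsed_orbit_bounded
    (γ : ℝ)
    (f : ℝ → ℝ)
    (hf : ∀ y : ℝ, f y = (7 / 10) * y - 6 / 5 - (6 / 5) * Real.arctan (15 * y))
    (Δ : ℕ) (hΔ : 1 ≤ Δ)
    (x : ℕ → ℝ) (hx1 : x 1 = 7 / 20)
    (hx : ∀ n : ℕ, 1 ≤ n → x (n + 1) = if Δ ∣ n then f (x n) + γ else f (x n)) :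
    ∀ n : ℕ, 1 ≤ n →
      |x n| ≤ 7 / 20 + (|γ| + 4 + 2 * Real.pi) / (1 - (7 / 10) ^ Δ) + |γ| +
        2 * (4 + 2 * Real.pi) := by
  intro n hn
  obtain ⟨n, rfl⟩ := Nat.exists_eq_add_of_le' hn
  have hpi := Real.pi_pos
  have hq : (0 : ℝ) < 1 - (7 / 10) ^ Δ :=
    sub_pos.2 (pow_lt_one₀ (by norm_num) (by norm_num) (by omega))
  have hbound : |x (n + 1)| - (4 + 2 * Real.pi) ≤ |γ| / (1 - (7 / 10) ^ Δ) := by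
    refine le_div_one_sub_pow_of_impulsed_contraction (q := 7 / 10) (by norm_num) (by norm_num)
      (abs_nonneg γ) hΔ (v := fun k => |x (k + 1)| - (4 + 2 * Real.pi)) ?_ (fun k => ?_) n
    · norm_num [hx1, abs_of_pos]
      linarith
    · have hstep := abs_supplyDemand_le (x (k + 1))
      rw [← hf] at hstep
      simp only [hx (k + 1) (Nat.le_add_left 1 k)]
      split_ifs
      · linarith [abs_add_le (f (x (k + 1))) γ]
      · linarith
  have hmono : |γ| / (1 - (7 / 10) ^ Δ) ≤ (|γ| + 4 + 2 * Real.pi) / (1 - (7 / 10) ^ Δ) := by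
    gcongr
    linarith
  linarith [abs_nonneg γ]
end
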